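/- Let (S_n : n ≥ 0) be the M_d(d₁,d₂) balanced excited random walk with d₁ + d₂ > d, r := d₁ + d₂ − d, and suppose d₂ − r ≥ 3. Then almost surely the asymptotic fraction of time steps at which the walk moves in one of the last d₂ − r coordinates (coordinates d₁+1,…,d) is bounded below by a positive constant; consequently the walk is transient. -/

import Mathlib

open MeasureTheory Filter

/-- The `i`-th canonical unit vector of `ℤ^d`. -/
def unitVec (d : ℕ) (i : Fin d) : Fin d → ℤ := fun j => if j = i then 1 else 0

/-- `S` is a balanced excited random walk `M_d(d₁,d₂)` under `P`:
it starts at `0` a.s., is measurable, and conditionally on any finite trajectory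
`S_0 = h 0, …, S_n = h n`, if `h n` is a new site the walk jumps to `h n ± e_i`
with probability `1/(2d₁)` for each `i < d₁` (`0`-indexed), while if `h n` is an
old site it jumps to `h n ± e_i` with probability `1/(2d₂)` for each
`d - d₂ ≤ i < d` (`0`-indexed). -/
def IsBERW {Ω : Type*} [MeasurableSpace Ω] (d d₁ d₂ : ℕ) (P : Measure Ω)
    (S : ℕ → Ω → Fin d → ℤ) : Prop :=
  (∀ n, Measurable (S n)) ∧
  (∀ᵐ ω ∂P, S 0 ω = 0) ∧
  (∀ (n : ℕ) (h : ℕ → Fin d → ℤ), (∀ k < n, h n ≠ h k) →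
    ∀ i : Fin d, i.1 < d₁ → ∀ ε : ℤ, ε = 1 ∨ ε = -1 →
      P {ω | (∀ k ≤ n, S k ω = h k) ∧ S (n + 1) ω = h n + ε • unitVec d i}
        = P {ω | ∀ k ≤ n, S k ω = h k} / (2 * d₁)) ∧
  (∀ (n : ℕ) (h : ℕ → Fin d → ℤ), (∃ k < n, h n = h k) →
    ∀ i : Fin d, d - d₂ ≤ i.1 → ∀ ε : ℤ, ε = 1 ∨ ε = -1 →
      P {ω | (∀ k ≤ n, S k ω = h k) ∧ S (n + 1) ω = h n + ε • unitVec d i}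
        = P {ω | ∀ k ≤ n, S k ω = h k} / (2 * d₂))

/-- Transience: almost surely, every site is visited only finitely many times. -/
def IsTransientWalk {Ω : Type*} [MeasurableSpace Ω] (d : ℕ) (P : Measure Ω)
    (S : ℕ → Ω → Fin d → ℤ) : Prop :=
  ∀ᵐ ω ∂P, ∀ x : Fin d → ℤ, {n : ℕ | S n ω = x}.Finite

/-- The potential `(C + ∑_{i ∈ A} x_i²)^(-1/4)` with `C = 1000`. -/
noncomputable def coordPotential {d : ℕ} (A : Finset (Fin d)) (x : Fin d → ℤ) : ℝ :=
  (∑ i ∈ A, (x i : ℝ) ^ 2 + 1000) ^ (-(1 / 4) : ℝ)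

theorem coordPotential_pos {d : ℕ} (A : Finset (Fin d)) (x : Fin d → ℤ) :
    0 < coordPotential A x := by
  have : 0 ≤ ∑ i ∈ A, (x i : ℝ) ^ 2 := Finset.sum_nonneg fun i _ => sq_nonneg _
  unfold coordPotential
  positivity

theorem one_add_rpow_neg_quarter_le {t : ℝ} (h₁ : -(1 / 20) ≤ t) (h₂ : t ≤ 1 / 20) :
    (1 + t) ^ (-(1 / 4) : ℝ) ≤ 1 - t / 4 + 18 / 100 * t ^ 2 := by
  set p : ℝ := 1 - t / 4 + 18 / 100 * t ^ 2 with hp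
  have hp0 : 0 < p := by nlinarith [sq_nonneg t]
  have ht : 0 < 1 + t := by linarith
  have e₁ : 1 - t / 2 + 418 / 1000 * t ^ 2 ≤ p ^ 2 := by
    have : p ^ 2 - (1 - t / 2 + 418 / 1000 * t ^ 2)
        = t ^ 2 * (45 / 10000 - 9 / 100 * t + 324 / 10000 * t ^ 2) := by rw [hp]; ring
    have h : 0 ≤ t ^ 2 * (45 / 10000 - 9 / 100 * t + 324 / 10000 * t ^ 2) :=
      mul_nonneg (sq_nonneg _) (by nlinarith [sq_nonneg t])
    linarith
  have e₂ : 1 - t + 1065 / 1000 * t ^ 2 ≤ (1 - t / 2 + 418 / 1000 * t ^ 2) ^ 2 := by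
    have : (1 - t / 2 + 418 / 1000 * t ^ 2) ^ 2 - (1 - t + 1065 / 1000 * t ^ 2)
        = t ^ 2 * (21 / 1000 - 418 / 1000 * t + (418 / 1000) ^ 2 * t ^ 2) := by ring
    have h : 0 ≤ t ^ 2 * (21 / 1000 - 418 / 1000 * t + (418 / 1000) ^ 2 * t ^ 2) :=
      mul_nonneg (sq_nonneg _) (by nlinarith [sq_nonneg t])
    linarith
  have e₃ : 1 ≤ (1 + t) * (1 - t + 1065 / 1000 * t ^ 2) := by
    have : (1 + t) * (1 - t + 1065 / 1000 * t ^ 2) - 1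
        = t ^ 2 * (65 / 1000 + 1065 / 1000 * t) := by ring
    have h : 0 ≤ t ^ 2 * (65 / 1000 + 1065 / 1000 * t) :=
      mul_nonneg (sq_nonneg _) (by linarith)
    linarith
  have e₄ : (1 - t / 2 + 418 / 1000 * t ^ 2) ^ 2 ≤ p ^ 4 := by
    have : p ^ 4 = (p ^ 2) ^ 2 := by ring
    rw [this]
    exact pow_le_pow_left₀ (by nlinarith [sq_nonneg t]) e₁ 2
  have key : (1 + t)⁻¹ ≤ p ^ 4 := by
    rw [inv_le_iff_one_le_mul₀' ht]
    exact e₃.trans (mul_le_mul_of_nonneg_left (e₂.trans e₄) ht.le)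
  calc (1 + t) ^ (-(1 / 4) : ℝ) = ((1 + t)⁻¹) ^ ((1 / 4) : ℝ) := by
        rw [Real.rpow_neg ht.le, Real.inv_rpow ht.le]
    _ ≤ (p ^ 4) ^ ((1 / 4) : ℝ) := Real.rpow_le_rpow (by positivity) key (by norm_num)
    _ = p := by
        rw [← Real.rpow_natCast, ← Real.rpow_mul hp0.le]; norm_num

theorem rpow_neg_quarter_add_le {u s : ℝ} (hu : 0 < u) (h₁ : -(u / 20) ≤ s) (h₂ : s ≤ u / 20) :
    (u + s) ^ (-(1 / 4) : ℝ)
      ≤ u ^ (-(1 / 4) : ℝ) * (1 - s / u / 4 + 18 / 100 * (s / u) ^ 2) := by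
  have h : u + s = u * (1 + s / u) := by field_simp
  have l₁ : -(1 / 20) ≤ s / u := by rw [le_div_iff₀ hu]; linarith
  have l₂ : s / u ≤ 1 / 20 := by rw [div_le_iff₀ hu]; linarith
  rw [h, Real.mul_rpow hu.le (by linarith)]
  exact mul_le_mul_of_nonneg_left (one_add_rpow_neg_quarter_le l₁ l₂) (by positivity)

theorem sum_sq_add_smul_unitVec {d : ℕ} {A : Finset (Fin d)} {i : Fin d} (hi : i ∈ A)
    (x : Fin d → ℤ) {ε : ℤ} (hε : ε = 1 ∨ ε = -1) :
    ∑ j ∈ A, (((x + ε • unitVec d i) j : ℤ) : ℝ) ^ 2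
      = ∑ j ∈ A, (x j : ℝ) ^ 2 + (1 + 2 * ε * x i) := by
  rw [← Finset.add_sum_erase _ _ hi,
    ← Finset.add_sum_erase A (fun j => (x j : ℝ) ^ 2) hi]
  have : ∑ j ∈ A.erase i, (((x + ε • unitVec d i) j : ℤ) : ℝ) ^ 2
      = ∑ j ∈ A.erase i, (x j : ℝ) ^ 2 := by
    refine Finset.sum_congr rfl fun j hj => ?_
    simp [unitVec, Finset.ne_of_mem_erase hj]
  rw [this]
  rcases hε with rfl | rfl <;> simp [unitVec] <;> ring

theorem coordPotential_add_of_notMem {d : ℕ} {A : Finset (Fin d)} {i : Fin d} (hi : i ∉ A)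
    (x : Fin d → ℤ) (ε : ℤ) :
    coordPotential A (x + ε • unitVec d i) = coordPotential A x := by
  unfold coordPotential
  congr 2
  refine Finset.sum_congr rfl fun j hj => ?_
  have : j ≠ i := fun h => hi (h ▸ hj)
  simp [unitVec, this]

/-- The potential is strictly superharmonic for a simple random walk moving along a set of
coordinates containing `A`, provided `A` has at least three elements. -/
theorem sum_coordPotential_lt {d : ℕ} {A B : Finset (Fin d)} (hAB : A ⊆ B) (hA : 3 ≤ A.card)
    (x : Fin d → ℤ) :
    ∑ i ∈ B, (coordPotential A (x + (1 : ℤ) • unitVec d i)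
      + coordPotential A (x + (-1 : ℤ) • unitVec d i)) < 2 * B.card * coordPotential A x := by
  set Q : ℝ := ∑ i ∈ A, (x i : ℝ) ^ 2 with hQ
  have hQ0 : 0 ≤ Q := Finset.sum_nonneg fun i _ => sq_nonneg _
  set u : ℝ := Q + 1000 with hu
  have hu0 : 0 < u := by linarith
  set g : ℝ := coordPotential A x with hg
  have hg0 : 0 < g := coordPotential_pos A x
  have hgu : u ^ (-(1 / 4) : ℝ) = g := rfl
  have one (i : Fin d) (hi : i ∈ A) :
      coordPotential A (x + (1 : ℤ) • unitVec d i)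
        + coordPotential A (x + (-1 : ℤ) • unitVec d i) - 2 * g
        ≤ g / u * (-(1 / 2) + 18 / 100 * (2 + 8 * (x i : ℝ) ^ 2) / u) := by
    have hxi : (x i : ℝ) ^ 2 ≤ Q :=
      Finset.single_le_sum (f := fun i => (x i : ℝ) ^ 2) (fun i _ => sq_nonneg _) hi
    have b₁ : 1 + 2 * |(x i : ℝ)| ≤ u / 20 := by
      nlinarith [sq_nonneg (|(x i : ℝ)| - 20), sq_abs (x i : ℝ)]
    have b₂ := neg_abs_le (x i : ℝ)
    have b₃ := le_abs_self (x i : ℝ)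
    have p₁ := rpow_neg_quarter_add_le (s := 1 + 2 * (x i : ℝ)) hu0 (by linarith) (by linarith)
    have p₂ := rpow_neg_quarter_add_le (s := 1 - 2 * (x i : ℝ)) hu0 (by linarith) (by linarith)
    have c₁ : coordPotential A (x + (1 : ℤ) • unitVec d i)
        = (u + (1 + 2 * (x i : ℝ))) ^ (-(1 / 4) : ℝ) := by
      unfold coordPotential
      rw [sum_sq_add_smul_unitVec hi x (Or.inl rfl)]
      congr 1; push_cast; ring
    have c₂ : coordPotential A (x + (-1 : ℤ) • unitVec d i)
        = (u + (1 - 2 * (x i : ℝ))) ^ (-(1 / 4) : ℝ) := by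
      unfold coordPotential
      rw [sum_sq_add_smul_unitVec hi x (Or.inr rfl)]
      congr 1; push_cast; ring
    rw [c₁, c₂]
    rw [hgu] at p₁ p₂
    have e : g * (1 - (1 + 2 * (x i : ℝ)) / u / 4 + 18 / 100 * ((1 + 2 * (x i : ℝ)) / u) ^ 2)
        + g * (1 - (1 - 2 * (x i : ℝ)) / u / 4 + 18 / 100 * ((1 - 2 * (x i : ℝ)) / u) ^ 2) - 2 * g
        = g / u * (-(1 / 2) + 18 / 100 * (2 + 8 * (x i : ℝ) ^ 2) / u) := by
      field_simp; ring
    linarith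
  have hsum : ∑ i ∈ B, (coordPotential A (x + (1 : ℤ) • unitVec d i)
      + coordPotential A (x + (-1 : ℤ) • unitVec d i) - 2 * g)
      = ∑ i ∈ A, (coordPotential A (x + (1 : ℤ) • unitVec d i)
      + coordPotential A (x + (-1 : ℤ) • unitVec d i) - 2 * g) := by
    refine (Finset.sum_subset hAB fun i _ hi => ?_).symm
    rw [coordPotential_add_of_notMem hi, coordPotential_add_of_notMem hi]
    ring
  have hle := Finset.sum_le_sum one
  rw [← hsum, ← Finset.mul_sum, Finset.sum_add_distrib, ← Finset.sum_div, ← Finset.mul_sum,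
    Finset.sum_add_distrib, ← Finset.mul_sum, ← hQ, Finset.sum_sub_distrib] at hle
  simp only [Finset.sum_const, nsmul_eq_mul] at hle
  have hm : (3 : ℝ) ≤ A.card := by exact_mod_cast hA
  have hneg : (A.card : ℝ) * -(1 / 2) + 18 / 100 * (A.card * 2 + 8 * Q) / u < 0 := by
    have : 18 / 100 * (A.card * 2 + 8 * Q) / u < (A.card : ℝ) * (1 / 2) := by
      rw [div_lt_iff₀ hu0]
      nlinarith
    linarith
  have := mul_neg_of_pos_of_neg (div_pos hg0 hu0) hneg
  linarith

section Steps

variable {Ω : Type*} [MeasurableSpace Ω] {d : ℕ} {P : Measure Ω} {S : ℕ → Ω → Fin d → ℤ}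

/-- The event that the first `n + 1` positions of the walk are `w 0, …, w n`. -/
def pathCylinder (S : ℕ → Ω → Fin d → ℤ) (n : ℕ) (w : ℕ → Fin d → ℤ) : Set Ω :=
  {ω | ∀ k ≤ n, S k ω = w k}

theorem measurableSet_pathCylinder (hS : ∀ n, Measurable (S n)) (n : ℕ) (w : ℕ → Fin d → ℤ) :
    MeasurableSet (pathCylinder S n w) := by
  have : pathCylinder S n w = ⋂ k, ⋂ (_ : k ≤ n), S k ⁻¹' {w k} := by
    ext ω; simp [pathCylinder]
  rw [this]
  exact MeasurableSet.iInter fun k => MeasurableSet.iInter fun _ =>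
    hS k (measurableSet_singleton _)

theorem lintegral_le_of_forall_pathCylinder (hS : ∀ n, Measurable (S n)) (n : ℕ)
    {f g : Ω → ENNReal}
    (h : ∀ w, ∫⁻ ω in pathCylinder S n w, f ω ∂P ≤ ∫⁻ ω in pathCylinder S n w, g ω ∂P) :
    ∫⁻ ω, f ω ∂P ≤ ∫⁻ ω, g ω ∂P := by
  let ext : (Fin (n + 1) → Fin d → ℤ) → ℕ → Fin d → ℤ :=
    fun v k => if hk : k < n + 1 then v ⟨k, hk⟩ else 0
  have hU : ⋃ v, pathCylinder S n (ext v) = Set.univ := by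
    refine Set.eq_univ_of_forall fun ω => Set.mem_iUnion.2 ⟨fun k => S k ω, fun k hk => ?_⟩
    have : k < n + 1 := by omega
    simp only [ext, this, dif_pos]
  have hD : Pairwise (Function.onFun Disjoint fun v => pathCylinder S n (ext v)) := by
    intro v v' hv
    refine Set.disjoint_left.2 fun ω h₁ h₂ => hv ?_
    funext k
    have e₁ := h₁ k (Nat.le_of_lt_succ k.2)
    have e₂ := h₂ k (Nat.le_of_lt_succ k.2)
    simpa [ext, Fin.is_le] using e₁.symm.trans e₂
  have hM := fun v => measurableSet_pathCylinder hS n (ext v)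
  rw [← setLIntegral_univ f, ← setLIntegral_univ g, ← hU, lintegral_iUnion hM hD,
    lintegral_iUnion hM hD]
  exact ENNReal.tsum_le_tsum fun v => h (ext v)

theorem add_smul_unitVec_inj (x : Fin d → ℤ) {i j : Fin d} {ε η : ℤ}
    (hε : ε = 1 ∨ ε = -1) (h : x + ε • unitVec d i = x + η • unitVec d j) :
    i = j ∧ ε = η := by
  have hi := congrFun (add_left_cancel h) i
  by_cases hij : i = j
  · subst hij
    exact ⟨rfl, by simpa [unitVec] using hi⟩
  · exfalso
    simp [unitVec, hij] at hi
    omega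

/-- If, on the event `C`, the variable `T` is uniform on the neighbours of `x` along the
directions in `D`, then integrals of functions of `T` over `C` are averages over neighbours. -/
theorem setLIntegral_uniform_neighbours [IsFiniteMeasure P] {C : Set Ω}
    {T : Ω → Fin d → ℤ} (hT : Measurable T) (x : Fin d → ℤ) (D : Finset (Fin d))
    (hD : D.Nonempty)
    (h : ∀ i ∈ D, ∀ ε : ℤ, ε = 1 ∨ ε = -1 →
      P (C ∩ {ω | T ω = x + ε • unitVec d i}) = P C / (2 * D.card))
    (F : (Fin d → ℤ) → ENNReal) :
    ∫⁻ ω in C, F (T ω) ∂P = P C / (2 * D.card) *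
      ∑ i ∈ D, (F (x + (1 : ℤ) • unitVec d i) + F (x + (-1 : ℤ) • unitVec d i)) := by
  classical
  set μ := (P.restrict C).map T with hμ
  let nb : Fin d × ℤ → Fin d → ℤ := fun q => x + q.2 • unitVec d q.1
  let E : Finset (Fin d × ℤ) := D ×ˢ {1, -1}
  have hE : ∀ q ∈ E, q.1 ∈ D ∧ (q.2 = 1 ∨ q.2 = -1) := fun q hq => by
    simpa [E] using hq
  have hinj : Set.InjOn nb E := fun q hq q' _ hqq => by
    obtain ⟨h₁, h₂⟩ := add_smul_unitVec_inj x (hE q hq).2 hqq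
    exact Prod.ext h₁ h₂
  have hμs : ∀ q ∈ E, μ {nb q} = P C / (2 * D.card) := fun q hq => by
    rw [hμ, Measure.map_apply hT (measurableSet_singleton _),
      Measure.restrict_apply (hT (measurableSet_singleton _)), Set.inter_comm]
    exact h q.1 (hE q hq).1 q.2 (hE q hq).2
  have hcard : (E.card : ENNReal) = 2 * D.card := by
    have : E.card = 2 * D.card := by
      rw [Finset.card_product, mul_comm]; rfl
    exact_mod_cast this
  have hD0 : (2 * D.card : ENNReal) ≠ 0 := by
    have : D.card ≠ 0 := Finset.card_ne_zero.2 hD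
    simpa using this
  have hDtop : (2 * D.card : ENNReal) ≠ ⊤ := by
    exact_mod_cast ENNReal.natCast_ne_top (2 * D.card)
  have hfull : μ (E.image nb) = μ Set.univ := by
    have h₁ : μ (E.image nb) = P C := by
      rw [← sum_measure_singleton, Finset.sum_image hinj, Finset.sum_congr rfl hμs,
        Finset.sum_const, nsmul_eq_mul, hcard, ENNReal.mul_div_cancel hD0 hDtop]
    rw [h₁, hμ, Measure.map_apply hT MeasurableSet.univ]
    simp
  have hnull : ∀ y, y ∉ E.image nb → μ {y} = 0 := fun y hy => by
    have h₁ : μ ((E.image nb : Set (Fin d → ℤ))ᶜ) = 0 := by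
      rw [measure_compl (Finset.measurableSet _) (measure_ne_top _ _), hfull, tsub_self]
    refine measure_mono_null ?_ h₁
    simpa using hy
  calc ∫⁻ ω in C, F (T ω) ∂P = ∫⁻ y, F y ∂μ := (lintegral_map (measurable_of_countable _) hT).symm
    _ = ∑' y, F y * μ {y} := lintegral_countable' _
    _ = ∑ y ∈ E.image nb, F y * μ {y} :=
        tsum_eq_sum fun y hy => by rw [hnull y hy, mul_zero]
    _ = ∑ q ∈ E, F (nb q) * (P C / (2 * D.card)) := by
        rw [Finset.sum_image hinj]
        exact Finset.sum_congr rfl fun q hq => by rw [hμs q hq]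
    _ = _ := by
        rw [← Finset.sum_mul, mul_comm, Finset.sum_product]
        congr 1
        exact Finset.sum_congr rfl fun i _ => by simp [nb]

/-- A bound on the sum of a function over neighbours bounds the corresponding integral. -/
theorem setLIntegral_ofReal_neighbours_le [IsFiniteMeasure P] {C : Set Ω}
    {T : Ω → Fin d → ℤ} (hT : Measurable T) (x : Fin d → ℤ) (D : Finset (Fin d))
    (hD : D.Nonempty)
    (h : ∀ i ∈ D, ∀ ε : ℤ, ε = 1 ∨ ε = -1 →
      P (C ∩ {ω | T ω = x + ε • unitVec d i}) = P C / (2 * D.card))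
    (F : (Fin d → ℤ) → ℝ) (hF : ∀ y, 0 ≤ F y) {G : ℝ}
    (hG : ∑ i ∈ D, (F (x + (1 : ℤ) • unitVec d i) + F (x + (-1 : ℤ) • unitVec d i))
      ≤ 2 * D.card * G) :
    ∫⁻ ω in C, ENNReal.ofReal (F (T ω)) ∂P ≤ ENNReal.ofReal G * P C := by
  have hD0 : (2 * D.card : ENNReal) ≠ 0 := by
    have : D.card ≠ 0 := Finset.card_ne_zero.2 hD
    simpa using this
  have hDtop : (2 * D.card : ENNReal) ≠ ⊤ := by
    exact_mod_cast ENNReal.natCast_ne_top (2 * D.card)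
  rw [setLIntegral_uniform_neighbours hT x D hD h (fun y => ENNReal.ofReal (F y))]
  have hs : ∑ i ∈ D, (ENNReal.ofReal (F (x + (1 : ℤ) • unitVec d i))
      + ENNReal.ofReal (F (x + (-1 : ℤ) • unitVec d i))) ≤ 2 * D.card * ENNReal.ofReal G := by
    calc _ = ENNReal.ofReal (∑ i ∈ D, (F (x + (1 : ℤ) • unitVec d i)
          + F (x + (-1 : ℤ) • unitVec d i))) := by
          rw [ENNReal.ofReal_sum_of_nonneg fun i _ => add_nonneg (hF _) (hF _)]
          exact Finset.sum_congr rfl fun i _ => (ENNReal.ofReal_add (hF _) (hF _)).symm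
      _ ≤ ENNReal.ofReal (2 * D.card * G) := ENNReal.ofReal_le_ofReal hG
      _ = _ := by
          rw [ENNReal.ofReal_mul (by positivity), ENNReal.ofReal_mul (by positivity)]
          simp
  calc _ ≤ P C / (2 * D.card) * (2 * D.card * ENNReal.ofReal G) := by gcongr
    _ = _ := by
      rw [← mul_assoc, ENNReal.div_mul_cancel hD0 hDtop, mul_comm]

theorem card_filter_val_lt {d₁ : ℕ} (h : d₁ ≤ d) :
    (Finset.univ.filter fun i : Fin d => i.1 < d₁).card = d₁ := by
  rw [Fin.card_filter_val_lt]; omega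

theorem card_filter_le_val (k : ℕ) :
    (Finset.univ.filter fun i : Fin d => k ≤ i.1).card = d - k := by
  have h := Finset.card_filter_add_card_filter_not (s := Finset.univ) fun i : Fin d => i.1 < k
  rw [Fin.card_filter_val_lt, Finset.card_univ, Fintype.card_fin] at h
  simp only [not_lt] at h
  omega

/-- One-step comparison for the balanced excited random walk: it suffices to compare `f` and `g`
on each cylinder, where `f` may depend on the next position and is averaged over it. -/
theorem IsBERW.lintegral_ofReal_le [IsFiniteMeasure P] {d₁ d₂ : ℕ} (hS : IsBERW d d₁ d₂ P S)
    (hd₁ : 1 ≤ d₁) (hd₁' : d₁ ≤ d) (hd₂ : 1 ≤ d₂) (hd₂' : d₂ ≤ d) (n : ℕ) {f g : Ω → ℝ}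
    (h : ∀ w : ℕ → Fin d → ℤ, ∃ (F : (Fin d → ℤ) → ℝ) (G : ℝ),
      (∀ y, 0 ≤ F y) ∧
      (∀ ω ∈ pathCylinder S n w, f ω = F (S (n + 1) ω)) ∧
      (∀ ω ∈ pathCylinder S n w, g ω = G) ∧
      ((∀ k < n, w n ≠ w k) →
        ∑ i : Fin d with i.1 < d₁, (F (w n + (1 : ℤ) • unitVec d i)
          + F (w n + (-1 : ℤ) • unitVec d i)) ≤ 2 * d₁ * G) ∧
      ((∃ k < n, w n = w k) →
        ∑ i : Fin d with d - d₂ ≤ i.1, (F (w n + (1 : ℤ) • unitVec d i)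
          + F (w n + (-1 : ℤ) • unitVec d i)) ≤ 2 * d₂ * G)) :
    ∫⁻ ω, ENNReal.ofReal (f ω) ∂P ≤ ∫⁻ ω, ENNReal.ofReal (g ω) ∂P := by
  obtain ⟨hmeas, -, hnew, hold⟩ := hS
  refine lintegral_le_of_forall_pathCylinder hmeas n fun w => ?_
  obtain ⟨F, G, hF, hf, hg, h₁, h₂⟩ := h w
  have hC := measurableSet_pathCylinder hmeas n w
  rw [setLIntegral_congr_fun hC fun ω hω => congrArg ENNReal.ofReal (hf ω hω),
    setLIntegral_congr_fun hC fun ω hω => congrArg ENNReal.ofReal (hg ω hω),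
    setLIntegral_const]
  have c₁ := card_filter_val_lt hd₁'
  have c₂ : (Finset.univ.filter fun i : Fin d => d - d₂ ≤ i.1).card = d₂ := by
    rw [card_filter_le_val]; omega
  by_cases hw : ∃ k < n, w n = w k
  · refine setLIntegral_ofReal_neighbours_le (hmeas (n + 1)) (w n)
      (Finset.univ.filter fun i : Fin d => d - d₂ ≤ i.1)
      (Finset.card_pos.1 (by omega)) (fun i hi ε hε => ?_) F hF (by rw [c₂]; exact h₂ hw)
    rw [c₂]
    exact hold n w hw i (by simpa using hi) ε hε
  · have hw' : ∀ k < n, w n ≠ w k := fun k hk e => hw ⟨k, hk, e⟩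
    refine setLIntegral_ofReal_neighbours_le (hmeas (n + 1)) (w n)
      (Finset.univ.filter fun i : Fin d => i.1 < d₁)
      (Finset.card_pos.1 (by omega)) (fun i hi ε hε => ?_) F hF (by rw [c₁]; exact h₁ hw')
    rw [c₁]
    exact hnew n w hw' i (by simpa using hi) ε hε

end Steps

section Transience

variable {Ω : Type*} [MeasurableSpace Ω] {d d₁ d₂ : ℕ} {P : Measure Ω}
  {S : ℕ → Ω → Fin d → ℤ}

/-- The event that the walk is at `y` at time `n` and has been there before. -/
def oldVisit (S : ℕ → Ω → Fin d → ℤ) (y : Fin d → ℤ) (n : ℕ) : Set Ω :=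
  {ω | S n ω = y ∧ ∃ k < n, S n ω = S k ω}

theorem measurableSet_oldVisit (hS : ∀ n, Measurable (S n)) (y : Fin d → ℤ) (n : ℕ) :
    MeasurableSet (oldVisit S y n) := by
  have : oldVisit S y n = S n ⁻¹' {y} ∩ ⋃ k, ⋃ (_ : k < n), {ω | S n ω = S k ω} := by
    ext ω; simp [oldVisit]
  rw [this]
  exact (hS n (measurableSet_singleton _)).inter <|
    MeasurableSet.iUnion fun k => MeasurableSet.iUnion fun _ => measurableSet_eq_fun (hS n) (hS k)

open Classical in
theorem IsBERW.exists_potential_decrease [IsFiniteMeasure P] (hS : IsBERW d d₁ d₂ P S)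
    (hd₁ : 1 ≤ d₁) (hd₁' : d₁ ≤ d) (hd₂ : 1 ≤ d₂) (hd₂' : d₂ ≤ d) (hover : d ≤ d₁ + d₂)
    (h3 : 3 ≤ d - d₁) (y : Fin d → ℤ) :
    ∃ δ : ℝ, 0 < δ ∧ ∀ n,
      ∫⁻ ω, ENNReal.ofReal (coordPotential {i : Fin d | d₁ ≤ i.1} (S (n + 1) ω)) ∂P
        + ENNReal.ofReal δ * P (oldVisit S y n)
      ≤ ∫⁻ ω, ENNReal.ofReal (coordPotential {i : Fin d | d₁ ≤ i.1} (S n ω)) ∂P := by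
  set A : Finset (Fin d) := {i : Fin d | d₁ ≤ i.1} with hA
  set B : Finset (Fin d) := {i : Fin d | d - d₂ ≤ i.1} with hB
  have hAB : A ⊆ B := fun i hi => by
    simp only [hA, hB, Finset.mem_filter, Finset.mem_univ, true_and] at hi ⊢
    omega
  have hAc : 3 ≤ A.card := by rw [hA, card_filter_le_val]; exact h3
  have hBc : B.card = d₂ := by rw [hB, card_filter_le_val]; omega
  have hlt := fun x => sum_coordPotential_lt hAB hAc x
  rw [hBc] at hlt
  have hd₂0 : (0 : ℝ) < 2 * d₂ := by positivity
  set V := coordPotential A with hV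
  have hV0 : ∀ x, 0 < V x := coordPotential_pos A
  set s : (Fin d → ℤ) → ℝ := fun x =>
    ∑ i ∈ B, (V (x + (1 : ℤ) • unitVec d i) + V (x + (-1 : ℤ) • unitVec d i)) with hs
  set δ : ℝ := V y - s y / (2 * d₂) with hδ
  have hδ0 : 0 < δ := by
    rw [hδ, sub_pos, div_lt_iff₀ hd₂0, mul_comm]; exact hlt y
  refine ⟨δ, hδ0, fun n => ?_⟩
  have hmeas := hS.1
  have hstep := hS.lintegral_ofReal_le hd₁ hd₁' hd₂ hd₂' n
    (f := fun ω => V (S (n + 1) ω) + (oldVisit S y n).indicator (fun _ => δ) ω)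
    (g := fun ω => V (S n ω)) (fun w => by
      set c : ℝ := if w n = y ∧ ∃ k < n, w n = w k then δ else 0 with hc
      refine ⟨fun z => V z + c, V (w n), fun z => ?_, fun ω hω => ?_, fun ω hω => ?_,
        fun hw => ?_, fun hw => ?_⟩
      · have : 0 ≤ c := by rw [hc]; split_ifs <;> simp [hδ0.le]
        exact add_nonneg (hV0 z).le this
      · have : ω ∈ oldVisit S y n ↔ (w n = y ∧ ∃ k < n, w n = w k) := by
          simp only [oldVisit, Set.mem_ofPred_eq, hω n le_rfl]
          refine and_congr_right fun _ => exists_congr fun k => and_congr_right fun hk => ?_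
          rw [hω k hk.le]
        simp only [Set.indicator_apply, this, hc]
      · simp only [hω n le_rfl]
      · have hc0 : c = 0 := by
          rw [hc, if_neg]; rintro ⟨-, k, hk, e⟩; exact hw k hk e
        have : ∀ i ∈ Finset.univ.filter fun i : Fin d => i.1 < d₁,
            (V (w n + (1 : ℤ) • unitVec d i) + c) + (V (w n + (-1 : ℤ) • unitVec d i) + c)
              = 2 * V (w n) := fun i hi => by
          have hi' : i ∉ A := by
            simp only [hA, Finset.mem_filter, Finset.mem_univ, true_and] at hi ⊢
            omega
          rw [hV, coordPotential_add_of_notMem hi', coordPotential_add_of_notMem hi', hc0]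
          ring
        rw [Finset.sum_congr rfl this, Finset.sum_const, card_filter_val_lt hd₁', nsmul_eq_mul]
        exact le_of_eq (by ring)
      · have e : ∑ i ∈ B, ((V (w n + (1 : ℤ) • unitVec d i) + c)
            + (V (w n + (-1 : ℤ) • unitVec d i) + c)) = s (w n) + 2 * d₂ * c := by
          have : (2 * d₂ * c : ℝ) = ∑ _i ∈ B, (c + c) := by
            rw [Finset.sum_const, hBc, nsmul_eq_mul]; ring
          rw [this, hs, ← Finset.sum_add_distrib]
          exact Finset.sum_congr rfl fun i _ => by ring
        change ∑ i ∈ B, _ ≤ _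
        rw [e]
        by_cases hy : w n = y
        · have : c = V (w n) - s (w n) / (2 * d₂) := by
            rw [hc, if_pos ⟨hy, hw⟩, hδ, hy]
          rw [this]
          have : 2 * (d₂ : ℝ) * (V (w n) - s (w n) / (2 * d₂))
              = 2 * d₂ * V (w n) - s (w n) := by field_simp
          linarith
        · have : c = 0 := by rw [hc, if_neg]; exact fun h => hy h.1
          rw [this]
          have := hlt (w n)
          simp only [hs]
          linarith)
  refine le_trans (le_of_eq ?_) hstep
  have hE := measurableSet_oldVisit hmeas y n
  have : ∀ ω, ENNReal.ofReal (V (S (n + 1) ω) + (oldVisit S y n).indicator (fun _ => δ) ω)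
      = ENNReal.ofReal (V (S (n + 1) ω))
        + (oldVisit S y n).indicator (fun _ => ENNReal.ofReal δ) ω := fun ω => by
    rw [ENNReal.ofReal_add (hV0 _).le (Set.indicator_nonneg (fun _ _ => hδ0.le) _)]
    by_cases h : ω ∈ oldVisit S y n <;> simp [h]
  simp only [this]
  rw [lintegral_add_right _ (measurable_const.indicator hE), lintegral_indicator_const hE]

/-- If the walk has at least three coordinates that are only moved at old sites, then it is
transient. -/
theorem IsBERW.isTransientWalk [IsProbabilityMeasure P] (hS : IsBERW d d₁ d₂ P S)
    (hd₁ : 1 ≤ d₁) (hd₁' : d₁ ≤ d) (hd₂ : 1 ≤ d₂) (hd₂' : d₂ ≤ d) (hover : d ≤ d₁ + d₂)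
    (h3 : 3 ≤ d - d₁) : IsTransientWalk d P S := by
  refine ae_all_iff.2 fun y => ?_
  obtain ⟨δ, hδ, hdec⟩ := hS.exists_potential_decrease hd₁ hd₁' hd₂ hd₂' hover h3 y
  set I : ℕ → ENNReal := fun n =>
    ∫⁻ ω, ENNReal.ofReal (coordPotential {i : Fin d | d₁ ≤ i.1} (S n ω)) ∂P with hI
  have hsum : ∀ N, I N + ∑ n ∈ Finset.range N, ENNReal.ofReal δ * P (oldVisit S y n) ≤ I 0 := by
    intro N
    induction N with
    | zero => simp
    | succ N ih =>
      rw [Finset.sum_range_succ, add_comm (∑ n ∈ _, _), ← add_assoc]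
      exact (add_le_add_left (hdec N) _).trans ih
  have hI0 : I 0 ≠ ⊤ := by
    have : I 0 = ∫⁻ _, ENNReal.ofReal (coordPotential {i : Fin d | d₁ ≤ i.1} 0) ∂P :=
      lintegral_congr_ae (hS.2.1.mono fun ω hω => by simp only [hω])
    rw [this]
    simp
  have hfin : ∑' n, P (oldVisit S y n) ≠ ⊤ := by
    have h₁ : ∑' n, ENNReal.ofReal δ * P (oldVisit S y n) ≤ I 0 :=
      ENNReal.tsum_le_of_sum_range_le fun N => le_add_self.trans (hsum N)
    rw [ENNReal.tsum_mul_left] at h₁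
    intro htop
    rw [htop, ENNReal.mul_top (by simpa using hδ)] at h₁
    exact hI0 (top_le_iff.1 h₁)
  filter_upwards [ae_finite_setOfPred_mem hfin] with ω hω
  have hnew : {n | S n ω = y ∧ ∀ k < n, S n ω ≠ S k ω}.Subsingleton := by
    rintro m ⟨hm, hm'⟩ n ⟨hn, hn'⟩
    rcases lt_trichotomy m n with h | h | h
    · exact absurd (hn.trans hm.symm) (hn' m h)
    · exact h
    · exact absurd (hm.trans hn.symm) (hm' n h)
  refine (hω.union hnew.finite).subset fun n hn => ?_
  by_cases h : ∃ k < n, S n ω = S k ω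
  · exact Or.inl ⟨hn, h⟩
  · exact Or.inr ⟨hn, fun k hk e => h ⟨k, hk, e⟩⟩

end Transience

section LastCoordinates

variable {Ω : Type*} [MeasurableSpace Ω] {d d₁ d₂ : ℕ} {P : Measure Ω}
  {S : ℕ → Ω → Fin d → ℤ}

/-- The number of steps before time `n` at which the path `w` moves in a coordinate `i ≥ d₁`. -/
def lastMoves (d₁ : ℕ) (w : ℕ → Fin d → ℤ) (n : ℕ) : ℕ :=
  ((Finset.range n).filter (fun k => ∃ i : Fin d, d₁ ≤ i.1 ∧ w (k + 1) i ≠ w k i)).card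

theorem lastMoves_succ (w : ℕ → Fin d → ℤ) (n : ℕ) :
    lastMoves d₁ w (n + 1)
      = lastMoves d₁ w n + if ∃ i : Fin d, d₁ ≤ i.1 ∧ w (n + 1) i ≠ w n i then 1 else 0 := by
  unfold lastMoves
  rw [Finset.range_add_one, Finset.filter_insert]
  split_ifs with h
  · rw [Finset.card_insert_of_notMem (by simp)]
  · rfl

theorem lastMoves_congr {w w' : ℕ → Fin d → ℤ} {n : ℕ} (h : ∀ k ≤ n, w k = w' k) :
    lastMoves d₁ w n = lastMoves d₁ w' n := by
  unfold lastMoves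
  congr 1
  refine Finset.filter_congr fun k hk => ?_
  have hk := Finset.mem_range.1 hk
  rw [h k hk.le, h (k + 1) hk]

theorem lastMoves_le (w : ℕ → Fin d → ℤ) (n : ℕ) : lastMoves d₁ w n ≤ n :=
  (Finset.card_filter_le _ _).trans (Finset.card_range n).le

theorem measurable_lastMoves (hS : ∀ n, Measurable (S n)) (n : ℕ) :
    Measurable fun ω => lastMoves d₁ (fun k => S k ω) n := by
  simp only [lastMoves, Finset.card_filter]
  refine Finset.measurable_sum _ fun k _ => Measurable.ite ?_ measurable_const measurable_const
  have : {ω | ∃ i : Fin d, d₁ ≤ i.1 ∧ S (k + 1) ω i ≠ S k ω i}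
      = ⋃ i : Fin d, ⋃ (_ : d₁ ≤ i.1), {ω | S (k + 1) ω i = S k ω i}ᶜ := by
    ext ω; simp
  rw [this]
  exact MeasurableSet.iUnion fun i => MeasurableSet.iUnion fun _ =>
    (measurableSet_eq_fun ((measurable_pi_apply i).comp (hS (k + 1)))
      ((measurable_pi_apply i).comp (hS k))).compl

open Classical in
/-- Weight of the position `x` when the set of previously visited sites is `V`: it is `a` at an
old site, `b` at a new site with an old neighbour in one of the first `d₁` directions, and `1`
otherwise. -/
noncomputable def siteWeight (d₁ : ℕ) (a b : ℝ) (V : Set (Fin d → ℤ)) (x : Fin d → ℤ) : ℝ :=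
  if x ∈ V then a
  else if ∃ i : Fin d, i.1 < d₁ ∧ ∃ ε : ℤ, (ε = 1 ∨ ε = -1) ∧ x + ε • unitVec d i ∈ V then b
  else 1

theorem siteWeight_le_one {a b : ℝ} (ha : a ≤ 1) (hb : b ≤ 1) (V : Set (Fin d → ℤ))
    (x : Fin d → ℤ) : siteWeight d₁ a b V x ≤ 1 := by
  unfold siteWeight; split_ifs <;> linarith

theorem le_siteWeight {a b : ℝ} (hab : a ≤ b) (hb : b ≤ 1) (V : Set (Fin d → ℤ))
    (x : Fin d → ℤ) : a ≤ siteWeight d₁ a b V x := by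
  unfold siteWeight; split_ifs <;> linarith

theorem siteWeight_of_mem {a b : ℝ} {V : Set (Fin d → ℤ)} {x : Fin d → ℤ} (h : x ∈ V) :
    siteWeight d₁ a b V x = a := if_pos h

theorem siteWeight_le_of_neighbour_mem {a b : ℝ} (hab : a ≤ b) {V : Set (Fin d → ℤ)}
    {x : Fin d → ℤ} {i : Fin d} (hi : i.1 < d₁) {ε : ℤ} (hε : ε = 1 ∨ ε = -1)
    (h : x + ε • unitVec d i ∈ V) : siteWeight d₁ a b V x ≤ b := by
  unfold siteWeight
  split_ifs with h₁ h₂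
  · exact hab
  · exact le_rfl
  · exact absurd ⟨i, hi, ε, hε, h⟩ h₂

theorem Finset.sum_le_card_mul_sub {ι : Type*} {D : Finset ι} {H : ι → ℝ} {B e : ℝ} {i : ι}
    (hi : i ∈ D) (hH : ∀ j ∈ D, H j ≤ B) (hHi : H i ≤ B - e) :
    ∑ j ∈ D, H j ≤ D.card * B - e := by
  classical
  have h₁ : ∑ j ∈ D.erase i, H j ≤ (D.erase i).card * B := by
    rw [← nsmul_eq_mul]
    exact Finset.sum_le_card_nsmul _ _ _ fun j hj => hH j (Finset.mem_of_mem_erase hj)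
  have h₂ : ((D.erase i).card : ℝ) + 1 = D.card := by
    exact_mod_cast Finset.card_erase_add_one hi
  rw [← Finset.add_sum_erase _ _ hi, ← h₂]
  linarith

theorem add_smul_unitVec_apply_ne (x : Fin d → ℤ) (i : Fin d) {ε : ℤ} (hε : ε = 1 ∨ ε = -1) :
    (x + ε • unitVec d i) i ≠ x i := by
  have hε0 : ε ≠ 0 := by omega
  simpa [unitVec] using hε0

/-- Sums over neighbours of the discounted site weight contract by a factor `ρ`. -/
theorem sum_half_pow_mul_siteWeight_le (hd₁ : 1 ≤ d₁) (hd₁' : d₁ < d) (hd₂ : 1 ≤ d₂)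
    (hd₂' : d₂ ≤ d) (hover : d ≤ d₁ + d₂) {a b ρ : ℝ} (ha : 0 < a) (hab : a ≤ b) (hb : b ≤ 1)
    (h₁ : 1 - 1 / (2 * d) ≤ ρ * a) (h₂ : 1 - (1 - a) / (2 * d) ≤ ρ * b) (h₃ : b ≤ ρ)
    (V V' : Set (Fin d → ℤ)) (x : Fin d → ℤ) (hV : V' = insert x V) (F : (Fin d → ℤ) → ℝ)
    (hF : ∀ z, F z = (1 / 2) ^ (if ∃ j : Fin d, d₁ ≤ j.1 ∧ z j ≠ x j then 1 else 0)
      * siteWeight d₁ a b V' z) :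
    (x ∉ V → ∑ i : Fin d with i.1 < d₁, (F (x + (1 : ℤ) • unitVec d i)
          + F (x + (-1 : ℤ) • unitVec d i)) ≤ 2 * d₁ * (ρ * siteWeight d₁ a b V x)) ∧
    (x ∈ V → ∑ i : Fin d with d - d₂ ≤ i.1, (F (x + (1 : ℤ) • unitVec d i)
          + F (x + (-1 : ℤ) • unitVec d i)) ≤ 2 * d₂ * (ρ * siteWeight d₁ a b V x)) := by
  have hd0 : (0 : ℝ) < d := by exact_mod_cast (by omega : 0 < d)
  have hsw0 : ∀ z, 0 ≤ siteWeight d₁ a b V' z := fun z => ha.le.trans (le_siteWeight hab hb V' z)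
  have hsw1 : ∀ z, siteWeight d₁ a b V' z ≤ 1 := siteWeight_le_one (hab.trans hb) hb V'
  have hFsw : ∀ z, F z ≤ siteWeight d₁ a b V' z := fun z => by
    rw [hF]
    exact mul_le_of_le_one_left (hsw0 z) (pow_le_one₀ (by norm_num) (by norm_num))
  have hF1 : ∀ z, F z ≤ 1 := fun z => (hFsw z).trans (hsw1 z)
  have hback (i : Fin d) (ε : ℤ) : x + ε • unitVec d i + (-ε) • unitVec d i = x := by
    rw [add_assoc, ← add_smul]; simp
  refine ⟨fun hx => ?_, fun hx => ?_⟩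
  · have hc := card_filter_val_lt hd₁'.le
    have hd₁0 : (0 : ℝ) < d₁ := by exact_mod_cast hd₁
    have hd₁d : (d₁ : ℝ) ≤ d := by exact_mod_cast hd₁'.le
    by_cases hn : ∃ i : Fin d, i.1 < d₁ ∧ ∃ ε : ℤ, (ε = 1 ∨ ε = -1) ∧ x + ε • unitVec d i ∈ V
    · have hwx : siteWeight d₁ a b V x = b := by
        rw [siteWeight, if_neg hx, if_pos hn]
      obtain ⟨i, hi, ε, hε, hmem⟩ := hn
      have hFa : F (x + ε • unitVec d i) ≤ a := by
        refine (hFsw _).trans (le_of_eq (siteWeight_of_mem ?_))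
        rw [hV]; exact Set.mem_insert_of_mem _ hmem
      have hsum := Finset.sum_le_card_mul_sub (D := Finset.univ.filter fun i : Fin d => i.1 < d₁)
        (H := fun i => F (x + (1 : ℤ) • unitVec d i) + F (x + (-1 : ℤ) • unitVec d i))
        (B := 2) (e := 1 - a) (i := i) (by simpa using hi)
        (fun j _ => by
          have := hF1 (x + (1 : ℤ) • unitVec d j)
          have := hF1 (x + (-1 : ℤ) • unitVec d j)
          linarith)
        (by
          have := hF1 (x + (1 : ℤ) • unitVec d i)
          have := hF1 (x + (-1 : ℤ) • unitVec d i)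
          rcases hε with rfl | rfl <;> linarith)
      rw [hc] at hsum
      refine hsum.trans ?_
      rw [hwx]
      have h₄ : (1 - a) / (2 * d) ≤ (1 - a) / (2 * d₁) :=
        div_le_div_of_nonneg_left (by linarith) (by positivity) (by linarith)
      have h₅ : 2 * (d₁ : ℝ) * (1 - (1 - a) / (2 * d₁)) ≤ 2 * d₁ * (ρ * b) :=
        mul_le_mul_of_nonneg_left (by linarith) (by positivity)
      have h₆ : 2 * (d₁ : ℝ) * (1 - (1 - a) / (2 * d₁)) = d₁ * 2 - (1 - a) := by
        field_simp
      linarith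
    · have hwx : siteWeight d₁ a b V x = 1 := by
        rw [siteWeight, if_neg hx, if_neg hn]
      have hxV : x ∈ V' := hV ▸ Set.mem_insert _ _
      have hle : ∀ i ∈ Finset.univ.filter fun i : Fin d => i.1 < d₁,
          F (x + (1 : ℤ) • unitVec d i) + F (x + (-1 : ℤ) • unitVec d i) ≤ 2 * b := fun i hi => by
        have hi' : i.1 < d₁ := by simpa using hi
        have e₁ := (hFsw (x + (1 : ℤ) • unitVec d i)).trans
          (siteWeight_le_of_neighbour_mem hab hi' (Or.inr rfl) ((hback i 1).symm ▸ hxV))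
        have e₂ := (hFsw (x + (-1 : ℤ) • unitVec d i)).trans
          (siteWeight_le_of_neighbour_mem hab hi' (ε := 1) (Or.inl rfl)
            (by have := hback i (-1); rw [neg_neg] at this; rw [this]; exact hxV))
        linarith
      refine (Finset.sum_le_card_nsmul _ _ _ hle).trans ?_
      rw [hc, nsmul_eq_mul, hwx]
      nlinarith
  · have hc : (Finset.univ.filter fun i : Fin d => d - d₂ ≤ i.1).card = d₂ := by
      rw [card_filter_le_val]; omega
    have hd₂0 : (0 : ℝ) < d₂ := by exact_mod_cast hd₂
    have hd₂d : (d₂ : ℝ) ≤ d := by exact_mod_cast hd₂'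
    have hhalf (ε : ℤ) (hε : ε = 1 ∨ ε = -1) : F (x + ε • unitVec d ⟨d₁, hd₁'⟩) ≤ 1 / 2 := by
      rw [hF, if_pos ⟨⟨d₁, hd₁'⟩, le_rfl, add_smul_unitVec_apply_ne x _ hε⟩, pow_one]
      have := hsw1 (x + ε • unitVec d ⟨d₁, hd₁'⟩)
      linarith
    have hsum := Finset.sum_le_card_mul_sub
      (D := Finset.univ.filter fun i : Fin d => d - d₂ ≤ i.1)
      (H := fun i => F (x + (1 : ℤ) • unitVec d i) + F (x + (-1 : ℤ) • unitVec d i))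
      (B := 2) (e := 1) (i := ⟨d₁, hd₁'⟩) (by simp; omega)
      (fun j _ => by
        have := hF1 (x + (1 : ℤ) • unitVec d j)
        have := hF1 (x + (-1 : ℤ) • unitVec d j)
        linarith)
      (by
        have := hhalf 1 (Or.inl rfl)
        have := hhalf (-1) (Or.inr rfl)
        linarith)
    rw [hc] at hsum
    refine hsum.trans ?_
    rw [siteWeight_of_mem hx]
    have h₄ : (1 : ℝ) / (2 * d) ≤ 1 / (2 * d₂) :=
      div_le_div_of_nonneg_left (by norm_num) (by positivity) (by linarith)
    have h₅ : 2 * (d₂ : ℝ) * (1 - 1 / (2 * d₂)) ≤ 2 * d₂ * (ρ * a) :=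
      mul_le_mul_of_nonneg_left (by linarith) (by positivity)
    have h₆ : 2 * (d₂ : ℝ) * (1 - 1 / (2 * d₂)) = d₂ * 2 - 1 := by
      field_simp
    linarith

/-- Exponential decay of `E[2^(-N_n)]`, where `N_n` counts moves in the coordinates `i ≥ d₁`. -/
theorem IsBERW.exists_lintegral_half_pow_lastMoves_le [IsProbabilityMeasure P]
    (hS : IsBERW d d₁ d₂ P S) (hd₁ : 1 ≤ d₁) (hd₁' : d₁ < d) (hd₂ : 1 ≤ d₂) (hd₂' : d₂ ≤ d)
    (hover : d ≤ d₁ + d₂) :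
    ∃ a ρ : ℝ, 0 < a ∧ 0 < ρ ∧ ρ < 1 ∧ ∀ n,
      ∫⁻ ω, ENNReal.ofReal ((1 / 2) ^ lastMoves d₁ (fun k => S k ω) n) ∂P
        ≤ ENNReal.ofReal (a⁻¹ * ρ ^ n) := by
  have hd0 : (1 : ℝ) ≤ d := by exact_mod_cast (by omega : 1 ≤ d)
  set q : ℝ := 1 / (2 * d) with hq
  have hq0 : 0 < q := by positivity
  have hq1 : q ≤ 1 / 2 := by
    rw [hq, div_le_div_iff₀ (by positivity) (by norm_num)]; linarith
  set a : ℝ := 1 - q / 2 with ha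
  set b : ℝ := 1 - q ^ 2 / 4 with hb
  have ha0 : 0 < a := by linarith
  have hab : a ≤ b := by nlinarith
  have hb1 : b < 1 := by have := pow_pos hq0 2; linarith
  have hb0 : 0 < b := ha0.trans_le hab
  have h₁ : 1 - 1 / (2 * (d : ℝ)) ≤ b * a := by rw [← hq, ha, hb]; nlinarith [pow_pos hq0 3]
  have h₂ : 1 - (1 - a) / (2 * d) ≤ b * b := by
    have : (1 - a) / (2 * d) = q * (q / 2) := by rw [ha, hq]; field_simp; ring
    rw [this, hb]; nlinarith [pow_pos hq0 4]
  refine ⟨a, b, ha0, hb0, hb1, ?_⟩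
  let Z : ℕ → Ω → ℝ := fun n ω => (1 / 2) ^ lastMoves d₁ (fun k => S k ω) n
    * siteWeight d₁ a b {y | ∃ k < n, S k ω = y} (S n ω)
  have hstep (n : ℕ) : ∫⁻ ω, ENNReal.ofReal (Z (n + 1) ω) ∂P
      ≤ ∫⁻ ω, ENNReal.ofReal (b * Z n ω) ∂P := by
    refine hS.lintegral_ofReal_le hd₁ hd₁'.le hd₂ hd₂' n fun w => ?_
    set V : Set (Fin d → ℤ) := {y | ∃ k < n, w k = y} with hV
    set V' : Set (Fin d → ℤ) := {y | ∃ k < n + 1, w k = y} with hV'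
    have hVV : V' = insert (w n) V := by
      ext y
      simp only [hV, hV', Set.mem_ofPred_eq, Set.mem_insert_iff, Nat.lt_succ_iff_lt_or_eq,
        or_and_right, exists_or, exists_eq_left]
      rw [or_comm, eq_comm]
    set M : ℝ := (1 / 2) ^ lastMoves d₁ w n with hM
    have hM0 : 0 < M := by positivity
    let F : (Fin d → ℤ) → ℝ := fun z =>
      (1 / 2) ^ (if ∃ j : Fin d, d₁ ≤ j.1 ∧ z j ≠ w n j then 1 else 0) * siteWeight d₁ a b V' z
    obtain ⟨hnew, hold⟩ := sum_half_pow_mul_siteWeight_le hd₁ hd₁' hd₂ hd₂' hover ha0 hab hb1.le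
      h₁ h₂ le_rfl V V' (w n) hVV F fun _ => rfl
    have hcyl : ∀ ω ∈ pathCylinder S n w, lastMoves d₁ (fun k => S k ω) n = lastMoves d₁ w n :=
      fun ω hω => lastMoves_congr hω
    refine ⟨fun z => M * F z, b * (M * siteWeight d₁ a b V (w n)), fun z => ?_, fun ω hω => ?_,
      fun ω hω => ?_, fun hw => ?_, fun hw => ?_⟩
    · have := ha0.le.trans (le_siteWeight (d₁ := d₁) hab hb1.le V' z)
      positivity
    · have : {y | ∃ k < n + 1, S k ω = y} = V' := by
        ext y
        refine exists_congr fun k => and_congr_right fun hk => ?_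
        rw [hω k (Nat.le_of_lt_succ hk)]
      simp only [Z, F, this, lastMoves_succ, hcyl ω hω, pow_add, hω n le_rfl, mul_assoc, hM]
    · have : {y | ∃ k < n, S k ω = y} = V := by
        ext y
        refine exists_congr fun k => and_congr_right fun hk => ?_
        rw [hω k hk.le]
      simp only [Z, this, hcyl ω hω, hω n le_rfl, hM]
    · have h := mul_le_mul_of_nonneg_left
        (hnew fun ⟨k, hk, e⟩ => hw k hk e.symm) hM0.le
      rw [Finset.mul_sum] at h
      simp only [mul_add] at h
      exact h.trans (le_of_eq (by ring))
    · have h := mul_le_mul_of_nonneg_left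
        (hold (hw.imp fun k hk => ⟨hk.1, hk.2.symm⟩)) hM0.le
      rw [Finset.mul_sum] at h
      simp only [mul_add] at h
      exact h.trans (le_of_eq (by ring))
  have hZ (n : ℕ) : ∫⁻ ω, ENNReal.ofReal (Z n ω) ∂P ≤ ENNReal.ofReal (b ^ n) := by
    induction n with
    | zero =>
      have : ∀ ω, ENNReal.ofReal (Z 0 ω) ≤ 1 := fun ω => by
        rw [← ENNReal.ofReal_one]
        refine ENNReal.ofReal_le_ofReal ?_
        simpa [Z, lastMoves] using siteWeight_le_one (hab.trans hb1.le) hb1.le _ _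
      simpa using lintegral_mono (μ := P) this
    | succ n ih =>
      refine (hstep n).trans ?_
      simp only [ENNReal.ofReal_mul hb0.le]
      rw [lintegral_const_mul' _ _ ENNReal.ofReal_ne_top, pow_succ', ENNReal.ofReal_mul hb0.le]
      gcongr
  intro n
  have hle : ∀ ω, ENNReal.ofReal ((1 / 2) ^ lastMoves d₁ (fun k => S k ω) n)
      ≤ ENNReal.ofReal a⁻¹ * ENNReal.ofReal (Z n ω) := fun ω => by
    rw [← ENNReal.ofReal_mul (by positivity)]
    refine ENNReal.ofReal_le_ofReal ?_
    rw [inv_mul_eq_div, le_div_iff₀ ha0]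
    exact mul_le_mul_of_nonneg_left (le_siteWeight hab hb1.le _ _) (by positivity)
  refine (lintegral_mono hle).trans ?_
  rw [lintegral_const_mul' _ _ ENNReal.ofReal_ne_top, ENNReal.ofReal_mul (by positivity)]
  gcongr
  exact hZ n

/-- The number of moves in the coordinates `i ≥ d₁` grows at least linearly. -/
theorem IsBERW.exists_eventually_lt_lastMoves [IsProbabilityMeasure P]
    (hS : IsBERW d d₁ d₂ P S) (hd₁ : 1 ≤ d₁) (hd₁' : d₁ < d) (hd₂ : 1 ≤ d₂) (hd₂' : d₂ ≤ d)
    (hover : d ≤ d₁ + d₂) :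
    ∃ c : ℝ, 0 < c ∧ ∀ᵐ ω ∂P, ∀ᶠ n : ℕ in atTop,
      c * n < lastMoves d₁ (fun k => S k ω) n := by
  obtain ⟨a, ρ, ha, hρ0, hρ1, hle⟩ :=
    hS.exists_lintegral_half_pow_lastMoves_le hd₁ hd₁' hd₂ hd₂' hover
  set σ : ℝ := (1 + ρ) / 2 with hσ
  have hσ0 : 0 < σ := by linarith
  have hσ1 : σ < 1 := by linarith
  have hρσ : ρ / σ < 1 := by rw [div_lt_one hσ0]; linarith
  have hlog2 : 0 < Real.log 2 := Real.log_pos (by norm_num)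
  set c : ℝ := -Real.log σ / Real.log 2 with hc
  have hc0 : 0 < c := div_pos (neg_pos.2 (Real.log_neg hσ0 hσ1)) hlog2
  have hclog : c * Real.log 2 = -Real.log σ := by rw [hc]; field_simp
  refine ⟨c, hc0, ?_⟩
  set E : ℕ → Set Ω := fun n => {ω | (lastMoves d₁ (fun k => S k ω) n : ℝ) ≤ c * n} with hE
  have hPE (n : ℕ) : P (E n) ≤ ENNReal.ofReal (a⁻¹ * (ρ / σ) ^ n) := by
    have hsub : E n ⊆ {ω | ENNReal.ofReal (σ ^ n)
        ≤ ENNReal.ofReal ((1 / 2) ^ lastMoves d₁ (fun k => S k ω) n)} := fun ω hω => by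
      refine ENNReal.ofReal_le_ofReal ?_
      rw [← Real.log_le_log_iff (by positivity) (by positivity), Real.log_pow, Real.log_pow,
        one_div, Real.log_inv]
      have hn : (lastMoves d₁ (fun k => S k ω) n : ℝ) ≤ c * n := hω
      have h := mul_le_mul_of_nonneg_right hn hlog2.le
      have : c * n * Real.log 2 = -(n * Real.log σ) := by
        rw [mul_right_comm, hclog]; ring
      linarith
    have hm : Measurable fun ω =>
        ENNReal.ofReal ((1 / 2) ^ lastMoves d₁ (fun k => S k ω) n) :=
      (measurable_of_countable fun m : ℕ => ENNReal.ofReal ((1 / 2) ^ m)).comp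
        (measurable_lastMoves hS.1 n)
    refine (measure_mono hsub).trans ((meas_ge_le_lintegral_div hm.aemeasurable
      (by simpa using pow_pos hσ0 n) ENNReal.ofReal_ne_top).trans ?_)
    refine (ENNReal.div_le_div_right (hle n) _).trans (le_of_eq ?_)
    rw [← ENNReal.ofReal_div_of_pos (pow_pos hσ0 n), div_pow ρ σ, mul_div_assoc]
  have hsum : ∑' n, P (E n) ≠ ⊤ := by
    have hs : Summable fun n : ℕ => a⁻¹ * (ρ / σ) ^ n :=
      (summable_geometric_of_lt_one (by positivity) hρσ).mul_left _
    exact ne_top_of_le_ne_top hs.tsum_ofReal_ne_top (ENNReal.tsum_le_tsum hPE)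
  filter_upwards [ae_eventually_notMem hsum] with ω hω
  filter_upwards [hω] with n hn
  exact not_le.1 hn

end LastCoordinates

/-- If `d₂ − r ≥ 3` (where `r = d₁ + d₂ − d`), then almost surely the asymptotic
fraction of time steps at which the walk moves in one of the last `d₂ − r`
coordinates (`0`-indexed: coordinates `i` with `d₁ ≤ i`) is bounded below by a
positive constant, and consequently the walk is transient. -/
theorem berw_transient_of_last_coords {Ω : Type*} [MeasurableSpace Ω]
    (P : Measure Ω) [IsProbabilityMeasure P] (d d₁ d₂ r : ℕ)
    (hd : 2 ≤ d) (hd₁ : 1 ≤ d₁) (hd₁' : d₁ ≤ d) (hd₂ : 1 ≤ d₂) (hd₂' : d₂ ≤ d)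
    (hover : d < d₁ + d₂) (hr : r = d₁ + d₂ - d) (h3 : 3 ≤ d₂ - r)
    (S : ℕ → Ω → Fin d → ℤ) (hS : IsBERW d d₁ d₂ P S) :
    (∃ c : ℝ, 0 < c ∧
      ∀ᵐ ω ∂P, c ≤ Filter.atTop.liminf (fun n : ℕ =>
        (((Finset.range n).filter
            (fun k => ∃ i : Fin d, d₁ ≤ i.1 ∧ S (k + 1) ω i ≠ S k ω i)).card : ℝ) / n)) ∧
    IsTransientWalk d P S := by
  have hd₁d : 3 ≤ d - d₁ := by omega
  refine ⟨?_, hS.isTransientWalk hd₁ hd₁' hd₂ hd₂' hover.le hd₁d⟩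
  obtain ⟨c, hc, h⟩ :=
    hS.exists_eventually_lt_lastMoves hd₁ (by omega) hd₂ hd₂' hover.le
  refine ⟨c, hc, ?_⟩
  filter_upwards [h] with ω hω
  refine le_liminf_of_le ?_ ?_
  · refine IsBoundedUnder.isCoboundedUnder_ge ⟨1, ?_⟩
    refine eventually_map.2 (Eventually.of_forall fun n => div_le_one_of_le₀ ?_ n.cast_nonneg)
    exact_mod_cast lastMoves_le (d₁ := d₁) (fun k => S k ω) n
  · filter_upwards [hω, eventually_gt_atTop 0] with n hn hn0
    rw [le_div_iff₀ (by exact_mod_cast hn0)]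
    exact hn.le
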